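/- For every integral weight μ ∈ P, every LS path π ∈ B(μ) and every i ∈ I: the endpoint wt(π) = π(1) lies in the integral weight lattice P, and every local minimum value of the piecewise-linear function H_i^π(t) = ⟨π(t), α_i∨⟩ on [0,1] is an integer; in particular m_i^π = min_{t∈[0,1]} H_i^π(t) is a nonpositive integer and H_i^π(1) − m_i^π is a nonnegative integer. -/

import Mathlib

open scoped Classical
noncomputable section

namespace LSPaper

/-- The clamp of a real number to the interval `[0,1]`; paths `[0,1] → V` are
encoded as functions `ℝ → V` that factor through this clamp. -/
def clamp01 (t : ℝ) : ℝ := max 0 (min 1 t)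

variable {V : Type*} [AddCommGroup V] [Module ℝ V]

/-- The straight-line path `π_ν(t) = t ν` (clamped outside `[0,1]`). -/
def straight (ν : V) : ℝ → V := fun t => clamp01 t • ν

/-- The dilation `(mπ)(t) = m • π(t)`. -/
def dilate (m : ℕ) (f : ℝ → V) : ℝ → V := fun t => (m : ℝ) • f t

/-- The concatenation `π_1 * ⋯ * π_m` of a list of paths:
`(π_1 * ⋯ * π_m)(t) = Σ_{l<k} π_l(1) + π_k(mt - k + 1)` for
`(k-1)/m ≤ t ≤ k/m`. -/
def concatList (l : List (ℝ → V)) : ℝ → V := fun t =>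
  let m := l.length
  let k : ℕ := max 1 (min m (⌈(m : ℝ) * t⌉.toNat))
  (((l.take (k - 1)).map fun f => f 1).sum) +
    (l.getD (k - 1) 0) ((m : ℝ) * t - ((k : ℝ) - 1))

/-- Subdivision of a path into `m` pieces:
`π_k(t) = π(t/m + (k-1)/m) - π((k-1)/m)` (here `k` runs over `0, …, m-1`). -/
def subdiv (m : ℕ) (f : ℝ → V) : List (ℝ → V) :=
  List.ofFn fun k : Fin m => fun t : ℝ =>
    f ((clamp01 t + (k : ℝ)) / m) - f ((k : ℝ) / m)

/-- The map `Σ_m : B(μ) → B(μ)^{⊗m}` (tensor factors encoded as a list):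
dilate by `m`, then subdivide into `m` pieces. -/
def SigmaMap (m : ℕ) (f : ℝ → V) : List (ℝ → V) := subdiv m (dilate m f)

/-- The weight of a tensor product (encoded as a list of paths): the sum of
the weights of the factors. -/
def tensWt (l : List (ℝ → V)) : V := (l.map fun f => f 1).sum

/-- A symmetrizable generalized Cartan matrix together with a realization:
an integral weight lattice `P` inside a real vector space `V`, linearly
independent simple roots `α i ∈ P` and simple coroots (as linear functionals)
with `⟨α j, α i∨⟩ = a i j`, taking integer values on `P`. -/
structure KacMoodyData (I : Type*) (V : Type*) [Fintype I] [DecidableEq I]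
    [AddCommGroup V] [Module ℝ V] where
  a : I → I → ℤ
  d : I → ℤ
  P : AddSubgroup V
  α : I → V
  coroot : I → V →ₗ[ℝ] ℝ
  diag : ∀ i, a i i = 2
  offDiag : ∀ i j, i ≠ j → a i j ≤ 0
  zeroIff : ∀ i j, a i j = 0 ↔ a j i = 0
  dPos : ∀ i, 0 < d i
  symmetrizable : ∀ i j, d i * a i j = d j * a j i
  cartanPairing : ∀ i j, coroot i (α j) = (a i j : ℝ)
  rootsIndep : LinearIndependent ℝ α
  corootsIndep : LinearIndependent ℝ coroot
  rootMem : ∀ i, α i ∈ P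
  pairingInt : ∀ i, ∀ v ∈ P, ∃ n : ℤ, coroot i v = (n : ℝ)
  latticeFree : ∃ n : ℕ, Nonempty (P ≃+ (Fin n → ℤ))

namespace KacMoodyData

variable {I : Type*} [Fintype I] [DecidableEq I]
variable (K : KacMoodyData I V)

/-- The simple reflection `r_i(x) = x - ⟨x, α_i∨⟩ α_i` as a linear map. -/
def reflMap (i : I) : V →ₗ[ℝ] V := LinearMap.id - (K.coroot i).smulRight (K.α i)

lemma reflMap_invol (i : I) : Function.Involutive (K.reflMap i) := by
  intro x
  have h2 : K.coroot i (K.α i) = 2 := by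
    have h := K.cartanPairing i i
    rw [K.diag i] at h
    simpa using h
  simp only [reflMap, LinearMap.sub_apply, LinearMap.id_apply, LinearMap.smulRight_apply,
    map_sub, map_smul, smul_eq_mul, h2]
  module

/-- The simple reflection `r_i` as a linear automorphism of `V`. -/
def refl (i : I) : V ≃ₗ[ℝ] V :=
  { K.reflMap i with
    invFun := K.reflMap i
    left_inv := K.reflMap_invol i
    right_inv := K.reflMap_invol i }

/-- The Weyl group `W`, generated by the simple reflections. -/
def weylGroup : Subgroup (V ≃ₗ[ℝ] V) := Subgroup.closure (Set.range K.refl)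

/-- The Weyl group orbit `W μ` of an integral weight. -/
def orbit (μ : V) : Set V := {ν | ∃ w ∈ K.weylGroup, ν = w μ}

/-- `Q_+ = Σ_i ℤ_{≥0} α_i`. -/
def Qplus : Set V := {v | ∃ c : I → ℕ, v = ∑ i, (c i : ℝ) • K.α i}

/-- One step of the order on a Weyl group orbit:  `ν' = r_β(ν)` for a positive
real root `β = w α_i ∈ Q_+` (with `β∨ = w α_i∨`, `r_β = w r_i w⁻¹`) such that
`⟨ν, β∨⟩ < 0`. -/
def StepDown (ν ν' : V) : Prop :=
  ∃ w ∈ K.weylGroup, ∃ i : I, w (K.α i) ∈ K.Qplus ∧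
    K.coroot i (w.symm ν) < 0 ∧ ν' = w (K.refl i (w.symm ν))

/-- There is a chain `ν = ξ_0, ξ_1, …, ξ_p = ν'` of steps down. -/
def chainLen (p : ℕ) (ν ν' : V) : Prop :=
  ∃ ξ : ℕ → V, ξ 0 = ν ∧ ξ p = ν' ∧ ∀ q < p, K.StepDown (ξ q) (ξ (q + 1))

/-- `dist(ν, ν')`: the maximal length of a chain from `ν` down to `ν'`. -/
def dist (ν ν' : V) : ℕ := sSup {p | K.chainLen p ν ν'}

/-- A `σ`-chain for `(ν, ν')`: a sequence `ν = ξ_0 > ξ_1 > ⋯ > ξ_p = ν'` with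
`dist(ξ_{q-1}, ξ_q) = 1` and `σ ⟨ξ_{q-1}, β_q∨⟩ ∈ ℤ_{<0}`, where `β_q` is the
positive real root with `ξ_q = r_{β_q} ξ_{q-1}`. -/
def SigmaChain (σ : ℚ) (ν ν' : V) : Prop :=
  ∃ p : ℕ, 0 < p ∧ ∃ ξ : ℕ → V, ξ 0 = ν ∧ ξ p = ν' ∧
    ∀ q < p, K.dist (ξ q) (ξ (q + 1)) = 1 ∧
      ∃ w ∈ K.weylGroup, ∃ i : I, w (K.α i) ∈ K.Qplus ∧
        ξ (q + 1) = w (K.refl i (w.symm (ξ q))) ∧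
        ∃ n : ℤ, n < 0 ∧ (σ : ℝ) * K.coroot i (w.symm (ξ q)) = (n : ℝ)

/-- The combinatorial datum of a Lakshmibai–Seshadri path of shape `μ`:
a strictly decreasing sequence `ν_1 > ν_2 > ⋯ > ν_s` in `W μ` together with
rationals `0 = σ_0 < σ_1 < ⋯ < σ_s = 1` admitting `σ_u`-chains (the `ν`'s are
indexed here by `Fin s`, i.e. `0, …, s-1`). -/
structure LSData (K : KacMoodyData I V) (μ : V) where
  s : ℕ
  spos : 0 < s
  ν : Fin s → V
  τ : Fin (s + 1) → ℚ
  mem : ∀ u, ν u ∈ K.orbit μ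
  strictDec : ∀ (u : ℕ) (h : u + 1 < s),
    Relation.TransGen K.StepDown (ν ⟨u, Nat.lt_of_succ_lt h⟩) (ν ⟨u + 1, h⟩)
  τ_zero : τ 0 = 0
  τ_last : τ (Fin.last s) = 1
  τ_mono : StrictMono τ
  chainCond : ∀ (u : ℕ) (h : u + 1 < s),
    K.SigmaChain (τ ⟨u + 1, Nat.lt_succ_of_lt h⟩) (ν ⟨u, Nat.lt_of_succ_lt h⟩) (ν ⟨u + 1, h⟩)

/-- The piecewise-linear path `[0,1] → ℝ ⊗ P` associated with an LS datum:
`π(t) = Σ_{k<u} (σ_k - σ_{k-1}) ν_k + (t - σ_{u-1}) ν_u` for `σ_{u-1} ≤ t ≤ σ_u`,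
encoded as the function `ℝ → V`, `t ↦ Σ_k (min t σ_{k+1} - min t σ_k) • ν_k`
(which is constant for `t ≤ 0` and `t ≥ 1`). -/
def LSData.path {K : KacMoodyData I V} {μ : V} (π : K.LSData μ) : ℝ → V := fun t =>
  ∑ k : Fin π.s,
    ((min t ((π.τ k.succ : ℚ) : ℝ)) - (min t ((π.τ k.castSucc : ℚ) : ℝ))) • π.ν k

/-- `B(μ)`: the set of Lakshmibai–Seshadri paths of shape `μ`. -/
def B (μ : V) : Set (ℝ → V) := {f | ∃ π : K.LSData μ, f = π.path}

/-- `H_i^π(t) = ⟨π(t), α_i∨⟩`. -/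
def H (i : I) (f : ℝ → V) : ℝ → ℝ := fun t => K.coroot i (f t)

/-- `m_i^π = min {H_i^π(t) : t ∈ [0,1]}`. -/
def mval (i : I) (f : ℝ → V) : ℝ := sInf (K.H i f '' Set.Icc 0 1)

/-- The raising root operator `ẽ_i` (the underlying path, before testing
whether it is defined): with `t_1 = min {t : H_i^π(t) = m_i^π}` and
`t_0 = max {t ≤ t_1 : H_i^π(t) = m_i^π + 1}`, the new path is `π(t)` for
`t ≤ t_0`, `r_i(π(t) - π(t_0)) + π(t_0)` for `t_0 ≤ t ≤ t_1` and `π(t) + α_i`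
for `t ≥ t_1`. -/
def eraw (i : I) (f : ℝ → V) : ℝ → V := fun t =>
  let m := K.mval i f
  let t1 := sInf {t | t ∈ Set.Icc (0 : ℝ) 1 ∧ K.H i f t = m}
  let t0 := sSup {t | t ∈ Set.Icc (0 : ℝ) t1 ∧ K.H i f t = m + 1}
  if t ≤ t0 then f t
  else if t ≤ t1 then K.refl i (f t - f t0) + f t0
  else f t + K.α i

/-- The lowering root operator `f̃_i` (the underlying path): with
`t_0 = max {t : H_i^π(t) = m_i^π}` and `t_1 = min {t ≥ t_0 : H_i^π(t) = m_i^π + 1}`,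
the new path is `π(t)` for `t ≤ t_0`, `r_i(π(t) - π(t_0)) + π(t_0)` for
`t_0 ≤ t ≤ t_1` and `π(t) - α_i` for `t ≥ t_1`. -/
def fraw (i : I) (f : ℝ → V) : ℝ → V := fun t =>
  let m := K.mval i f
  let t0 := sSup {t | t ∈ Set.Icc (0 : ℝ) 1 ∧ K.H i f t = m}
  let t1 := sInf {t | t ∈ Set.Icc t0 1 ∧ K.H i f t = m + 1}
  if t ≤ t0 then f t
  else if t ≤ t1 then K.refl i (f t - f t0) + f t0
  else f t - K.α i

/-- The root operator `ẽ_i`, with value `none` (the formal element `0`) when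
`m_i^π = 0`. -/
def eop (i : I) (f : ℝ → V) : Option (ℝ → V) :=
  if K.mval i f = 0 then none else some (K.eraw i f)

/-- The root operator `f̃_i`, with value `none` (the formal element `0`) when
`H_i^π(1) - m_i^π = 0`. -/
def fop (i : I) (f : ℝ → V) : Option (ℝ → V) :=
  if K.H i f 1 - K.mval i f = 0 then none else some (K.fraw i f)

/-- `ẽ_i^n π` (with `ẽ_i 0 = 0`). -/
def eIter (i : I) (n : ℕ) (f : ℝ → V) : Option (ℝ → V) :=
  (fun o => o.bind (K.eop i))^[n] (some f)

/-- `f̃_i^n π` (with `f̃_i 0 = 0`). -/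
def fIter (i : I) (n : ℕ) (f : ℝ → V) : Option (ℝ → V) :=
  (fun o => o.bind (K.fop i))^[n] (some f)

/-- `ε_i(π) = max {n ≥ 0 : ẽ_i^n π ≠ 0}`. -/
def epsilon (i : I) (f : ℝ → V) : ℕ := sSup {n | K.eIter i n f ≠ none}

/-- `φ_i(π) = max {n ≥ 0 : f̃_i^n π ≠ 0}`. -/
def phi (i : I) (f : ℝ → V) : ℕ := sSup {n | K.fIter i n f ≠ none}

/-- The Weyl group action on a normal crystal:
`S_i b = f̃_i^{⟨wt b, α_i∨⟩} b` if `⟨wt b, α_i∨⟩ ≥ 0` and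
`S_i b = ẽ_i^{-⟨wt b, α_i∨⟩} b` if `⟨wt b, α_i∨⟩ ≤ 0`. -/
def Sop (i : I) (f : ℝ → V) : Option (ℝ → V) :=
  if 0 ≤ K.coroot i (f 1) then K.fIter i (⌊K.coroot i (f 1)⌋.toNat) f
  else K.eIter i ((-⌊K.coroot i (f 1)⌋).toNat) f

/-- `SWord K [i₁, …, i_k] b = S_{i₁} S_{i₂} ⋯ S_{i_k} b`. -/
def SWord (K : KacMoodyData I V) : List I → Option (ℝ → V) → Option (ℝ → V)
  | [], o => o
  | i :: rest, o => (SWord K rest o).bind (K.Sop i)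

/-- `b` is extremal: for each `w ∈ W` (as a word in simple reflections) and
`i ∈ I`, `ẽ_i (S_w b) = 0` if `⟨wt (S_w b), α_i∨⟩ ≥ 0` and `f̃_i (S_w b) = 0`
if `⟨wt (S_w b), α_i∨⟩ ≤ 0`. -/
def Extremal (f : ℝ → V) : Prop :=
  ∀ (l : List I) (g : ℝ → V), K.SWord l (some f) = some g →
    ∀ i : I, (0 ≤ K.coroot i (g 1) → K.eop i g = none) ∧
      (K.coroot i (g 1) ≤ 0 → K.fop i g = none)

/-- Application of a word in the Kashiwara operators (`true` stands for `ẽ`,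
`false` for `f̃`), leftmost entry applied first. -/
def applyWord (K : KacMoodyData I V) :
    List (I × Bool) → Option (ℝ → V) → Option (ℝ → V)
  | [], o => o
  | p :: rest, o =>
      applyWord K rest (o.bind fun f => if p.2 then K.eop p.1 f else K.fop p.1 f)

/-- `B(μ)^{*m}`: the set of `m`-fold concatenations of LS paths of shape `μ`. -/
def ConcatSet (μ : V) (m : ℕ) : Set (ℝ → V) :=
  {g | ∃ l : List (ℝ → V), l.length = m ∧ (∀ f ∈ l, f ∈ K.B μ) ∧ g = concatList l}

/-- `ε_i` of a tensor product (encoded as a list of paths, Kashiwara's rule):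
`ε_i(b₁ ⊗ b₂) = max (ε_i b₁) (ε_i b₂ - ⟨wt b₁, α_i∨⟩)`. -/
def tensEps (K : KacMoodyData I V) (i : I) : List (ℝ → V) → ℤ
  | [] => 0
  | [b] => (K.epsilon i b : ℤ)
  | b :: c :: rest =>
      max ((K.epsilon i b : ℤ)) (tensEps K i (c :: rest) - ⌊K.coroot i (b 1)⌋)

/-- `φ_i` of a tensor product (Kashiwara's rule):
`φ_i(b₁ ⊗ b₂) = max (φ_i b₂) (φ_i b₁ + ⟨wt b₂, α_i∨⟩)`. -/
def tensPhi (K : KacMoodyData I V) (i : I) : List (ℝ → V) → ℤ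
  | [] => 0
  | [b] => (K.phi i b : ℤ)
  | b :: c :: rest =>
      max (tensPhi K i (c :: rest)) ((K.phi i b : ℤ) + ⌊K.coroot i (tensWt (c :: rest))⌋)

/-- `ẽ_i` on a tensor product (Kashiwara's rule):
`ẽ_i(b₁ ⊗ b₂) = (ẽ_i b₁) ⊗ b₂` if `φ_i(b₁) ≥ ε_i(b₂)`, else `b₁ ⊗ (ẽ_i b₂)`. -/
def tensE (K : KacMoodyData I V) (i : I) : List (ℝ → V) → Option (List (ℝ → V))
  | [] => none
  | [b] => (K.eop i b).map fun b' => [b']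
  | b :: c :: rest =>
      if K.tensEps i (c :: rest) ≤ (K.phi i b : ℤ) then
        (K.eop i b).map fun b' => b' :: c :: rest
      else (tensE K i (c :: rest)).map fun r' => b :: r'

/-- `f̃_i` on a tensor product (Kashiwara's rule):
`f̃_i(b₁ ⊗ b₂) = (f̃_i b₁) ⊗ b₂` if `φ_i(b₁) > ε_i(b₂)`, else `b₁ ⊗ (f̃_i b₂)`. -/
def tensF (K : KacMoodyData I V) (i : I) : List (ℝ → V) → Option (List (ℝ → V))
  | [] => none
  | [b] => (K.fop i b).map fun b' => [b']
  | b :: c :: rest =>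
      if K.tensEps i (c :: rest) < (K.phi i b : ℤ) then
        (K.fop i b).map fun b' => b' :: c :: rest
      else (tensF K i (c :: rest)).map fun r' => b :: r'

/-- `ẽ_i^n` on tensor products. -/
def tensEIter (i : I) (n : ℕ) (l : List (ℝ → V)) : Option (List (ℝ → V)) :=
  (fun o => o.bind (K.tensE i))^[n] (some l)

/-- `f̃_i^n` on tensor products. -/
def tensFIter (i : I) (n : ℕ) (l : List (ℝ → V)) : Option (List (ℝ → V)) :=
  (fun o => o.bind (K.tensF i))^[n] (some l)

end KacMoodyData

end LSPaper

namespace LSPaper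

namespace KacMoodyData

variable {I V : Type*} [Fintype I] [DecidableEq I] [AddCommGroup V] [Module ℝ V]
variable (K : KacMoodyData I V)

/-! ### Simple reflections and words -/

lemma refl_apply (i : I) (x : V) : K.refl i x = x - K.coroot i x • K.α i := rfl

lemma refl_refl (i : I) (x : V) : K.refl i (K.refl i x) = x := K.reflMap_invol i x

lemma refl_mul_self (i : I) : K.refl i * K.refl i = 1 :=
  LinearEquiv.ext fun x => K.refl_refl i x

lemma refl_inv (i : I) : (K.refl i)⁻¹ = K.refl i :=
  inv_eq_of_mul_eq_one_left (K.refl_mul_self i)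

lemma coroot_self (i : I) : K.coroot i (K.α i) = 2 := by
  rw [K.cartanPairing, K.diag]; norm_num

lemma refl_mem (i : I) : K.refl i ∈ K.weylGroup := Subgroup.subset_closure ⟨i, rfl⟩

lemma coroot_refl_self (i : I) (x : V) : K.coroot i (K.refl i x) = -K.coroot i x := by
  rw [refl_apply, map_sub, map_smul, coroot_self, smul_eq_mul]; ring

/-- The product of the simple reflections along a word. -/
def wordProd (L : List I) : V ≃ₗ[ℝ] V := (L.map K.refl).prod

@[simp] lemma wordProd_nil : K.wordProd [] = 1 := rfl

@[simp] lemma wordProd_cons (i : I) (L : List I) :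
    K.wordProd (i :: L) = K.refl i * K.wordProd L := by simp [wordProd]

@[simp] lemma wordProd_append (L M : List I) :
    K.wordProd (L ++ M) = K.wordProd L * K.wordProd M := by simp [wordProd]

lemma wordProd_mem (L : List I) : K.wordProd L ∈ K.weylGroup := by
  induction L with
  | nil => exact one_mem _
  | cons i L ih => rw [wordProd_cons]; exact mul_mem (K.refl_mem i) ih

lemma wordProd_reverse (L : List I) : K.wordProd L.reverse = (K.wordProd L)⁻¹ := by
  induction L with
  | nil => simp
  | cons i L ih => simp [ih, refl_inv]

lemma exists_word {w : V ≃ₗ[ℝ] V} (hw : w ∈ K.weylGroup) : ∃ L, K.wordProd L = w := by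
  induction hw using Subgroup.closure_induction with
  | mem x hx => obtain ⟨i, rfl⟩ := hx; exact ⟨[i], by simp⟩
  | one => exact ⟨[], rfl⟩
  | mul x y _ _ hx hy =>
    obtain ⟨L, rfl⟩ := hx
    obtain ⟨M, rfl⟩ := hy
    exact ⟨L ++ M, by simp⟩
  | inv x _ hx => obtain ⟨L, rfl⟩ := hx; exact ⟨L.reverse, K.wordProd_reverse L⟩

/-- The length of a Weyl group element: the least length of a word representing it. -/
def wordLength (w : V ≃ₗ[ℝ] V) : ℕ := sInf {n | ∃ L : List I, L.length = n ∧ K.wordProd L = w}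

lemma wordLength_wordProd_le (L : List I) : K.wordLength (K.wordProd L) ≤ L.length :=
  Nat.sInf_le ⟨L, rfl, rfl⟩

lemma exists_reduced_word {w : V ≃ₗ[ℝ] V} (hw : w ∈ K.weylGroup) :
    ∃ L : List I, L.length = K.wordLength w ∧ K.wordProd L = w := by
  obtain ⟨L, hL⟩ := K.exists_word hw
  exact Nat.sInf_mem (s := {n | ∃ L : List I, L.length = n ∧ K.wordProd L = w}) ⟨_, L, rfl, hL⟩

lemma wordLength_mul_wordProd_le {v : V ≃ₗ[ℝ] V} (hv : v ∈ K.weylGroup) (M : List I) :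
    K.wordLength (v * K.wordProd M) ≤ K.wordLength v + M.length := by
  obtain ⟨L, hL, rfl⟩ := K.exists_reduced_word hv
  rw [← hL, ← wordProd_append, ← List.length_append]
  exact K.wordLength_wordProd_le _

/-! ### The cone `Q_+` and the root lattice -/

lemma root_mem_Qplus (i : I) : K.α i ∈ K.Qplus :=
  ⟨fun k => if k = i then 1 else 0, by simp⟩

lemma add_mem_Qplus {x y : V} (hx : x ∈ K.Qplus) (hy : y ∈ K.Qplus) : x + y ∈ K.Qplus := by
  obtain ⟨c, rfl⟩ := hx
  obtain ⟨e, rfl⟩ := hy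
  exact ⟨c + e, by simp [add_smul, Finset.sum_add_distrib]⟩

lemma smul_mem_Qplus {x : V} (hx : x ∈ K.Qplus) {n : ℤ} (hn : 0 ≤ n) : (n : ℝ) • x ∈ K.Qplus := by
  obtain ⟨c, rfl⟩ := hx
  lift n to ℕ using hn
  exact ⟨fun i => n * c i, by simp [Finset.smul_sum, smul_smul]⟩

/-- The root lattice `Σ_i ℤ α_i`. -/
def rootLattice : AddSubgroup V := AddSubgroup.closure (Set.range K.α)

lemma rootLattice_le : K.rootLattice ≤ K.P := by
  rw [rootLattice, AddSubgroup.closure_le]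
  rintro _ ⟨i, rfl⟩
  exact K.rootMem i

lemma Qplus_subset_rootLattice {x : V} (hx : x ∈ K.Qplus) : x ∈ K.rootLattice := by
  obtain ⟨c, rfl⟩ := hx
  refine sum_mem fun i _ => ?_
  rw [Nat.cast_smul_eq_nsmul]
  exact nsmul_mem (AddSubgroup.subset_closure (Set.mem_range_self i)) _

lemma coroot_int_of_mem_rootLattice (i : I) {x : V} (hx : x ∈ K.rootLattice) :
    ∃ n : ℤ, K.coroot i x = n := K.pairingInt i x (K.rootLattice_le hx)

lemma weyl_mem_P {w : V ≃ₗ[ℝ] V} (hw : w ∈ K.weylGroup) {x : V} (hx : x ∈ K.P) : w x ∈ K.P := by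
  obtain ⟨L, rfl⟩ := K.exists_word hw
  induction L with
  | nil => exact hx
  | cons i L ih =>
    have h := ih (K.wordProd_mem L)
    obtain ⟨n, hn⟩ := K.pairingInt i _ h
    rw [wordProd_cons, LinearEquiv.mul_apply, refl_apply, hn, Int.cast_smul_eq_zsmul]
    exact sub_mem h (zsmul_mem (K.rootMem i) n)

/-! ### Rank two -/

/-- The alternating word of length `n` in `s` and `t` ending in `t`. -/
def altWord {J : Type*} (s t : J) : ℕ → List J
  | 0 => []
  | n + 1 => altWord t s n ++ [t]

lemma length_altWord {J : Type*} (s t : J) (n : ℕ) : (altWord s t n).length = n := by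
  induction n generalizing s t with
  | zero => rfl
  | succ n ih => simp [altWord, ih]

lemma altWord_add {J : Type*} (s t : J) (k m : ℕ) :
    ∃ L : List J, L.length = k ∧ altWord s t (k + m) = L ++ altWord s t m := by
  induction m generalizing s t with
  | zero => exact ⟨_, length_altWord s t k, by simp [altWord]⟩
  | succ m ih =>
    obtain ⟨L, hL, h⟩ := ih t s
    exact ⟨L, hL, by rw [← add_assoc, altWord, h, altWord, List.append_assoc]⟩

/-- The coordinates, with respect to `α_s` and `α_t`, of the image of `x α_s + y α_t` under an
alternating word, where `a = -⟨α_t, α_s∨⟩` and `b = -⟨α_s, α_t∨⟩`. -/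
def altCoef : ℤ → ℤ → ℕ → ℤ → ℤ → ℤ × ℤ
  | _, _, 0, x, y => (x, y)
  | a, b, n + 1, x, y => (altCoef b a n (b * x - y) x).swap

lemma wordProd_altWord_apply (s t : I) (n : ℕ) (x y : ℤ) :
    K.wordProd (altWord s t n) ((x : ℝ) • K.α s + (y : ℝ) • K.α t) =
      ((altCoef (-K.a s t) (-K.a t s) n x y).1 : ℝ) • K.α s +
        ((altCoef (-K.a s t) (-K.a t s) n x y).2 : ℝ) • K.α t := by
  induction n generalizing s t x y with
  | zero => simp [altWord, altCoef]
  | succ n ih =>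
    have h : K.refl t ((x : ℝ) • K.α s + (y : ℝ) • K.α t) =
        ((-K.a t s * x - y : ℤ) : ℝ) • K.α t + (x : ℝ) • K.α s := by
      simp only [refl_apply, map_add, map_smul, coroot_self, K.cartanPairing t s]
      push_cast
      module
    rw [altWord, wordProd_append, LinearEquiv.mul_apply, wordProd_cons, wordProd_nil, mul_one,
      h, ih, altCoef]
    simp [add_comm]

lemma altCoef_nonneg {a b : ℤ} (ha : 0 ≤ a) (hb : 0 ≤ b) (hab : 4 ≤ a * b) (n : ℕ) {x y : ℤ}
    (hx : 0 ≤ x) (hy : 0 ≤ y) (h : a * y ≤ 2 * x) :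
    0 ≤ (altCoef a b n x y).1 ∧ 0 ≤ (altCoef a b n x y).2 := by
  induction n generalizing a b x y with
  | zero => exact ⟨hx, hy⟩
  | succ n ih =>
    have h1 : 2 * y ≤ b * x := by
      have := mul_le_mul_of_nonneg_left h hb
      have := mul_le_mul_of_nonneg_right hab hy
      nlinarith
    rw [altCoef]
    exact (ih hb ha (by linarith) (by linarith) hx (by linarith)).symm

lemma refl_left_apply (s t : I) (x : V) (p q : ℝ) :
    K.refl s (x + p • K.α s + q • K.α t) =
      x + (-p - K.a s t * q - K.coroot s x) • K.α s + q • K.α t := by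
  simp only [refl_apply, map_add, map_smul, coroot_self, K.cartanPairing s t]
  module

lemma refl_right_apply (s t : I) (x : V) (p q : ℝ) :
    K.refl t (x + p • K.α s + q • K.α t) =
      x + p • K.α s + (-q - K.a t s * p - K.coroot t x) • K.α t := by
  simp only [refl_apply, map_add, map_smul, coroot_self, K.cartanPairing t s]
  module

/-- The braid relation for `r_s` and `r_t`, with the positivity of the shorter alternating words,
when `r_s r_t` has finite order. -/
lemma exists_braid {s t : I} (hst : s ≠ t) (h : K.a s t * K.a t s < 4) :
    ∃ m : ℕ, 0 < m ∧ K.wordProd (altWord s t m) = K.wordProd (altWord t s m) ∧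
      ∀ n < m, 0 ≤ (altCoef (-K.a s t) (-K.a t s) n 1 0).1 ∧
        0 ≤ (altCoef (-K.a s t) (-K.a t s) n 1 0).2 := by
  have ha := K.offDiag s t hst
  have hb := K.offDiag t s hst.symm
  have h0 := K.zeroIff s t
  have key : (K.a s t = 0 ∧ K.a t s = 0) ∨ (K.a s t = -1 ∧ K.a t s = -1) ∨
      (K.a s t = -1 ∧ K.a t s = -2) ∨ (K.a s t = -2 ∧ K.a t s = -1) ∨
      (K.a s t = -1 ∧ K.a t s = -3) ∨ (K.a s t = -3 ∧ K.a t s = -1) := by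
    by_cases hz : K.a s t = 0
    · exact Or.inl ⟨hz, h0.1 hz⟩
    have hz' : K.a t s ≠ 0 := fun h => hz (h0.2 h)
    have h1 : K.a s t ≤ -1 := by omega
    have h2 : K.a t s ≤ -1 := by omega
    have h3 : -3 ≤ K.a s t := by nlinarith
    have h4 : -3 ≤ K.a t s := by nlinarith
    generalize K.a s t = x at *
    generalize K.a t s = y at *
    interval_cases x <;> interval_cases y <;> simp_all
  have start (x : V) : x = x + (0 : ℝ) • K.α s + (0 : ℝ) • K.α t := by simp
  have braid (m : ℕ) (hm : ∀ x : V,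
      K.wordProd (altWord s t m) (x + (0 : ℝ) • K.α s + (0 : ℝ) • K.α t) =
        K.wordProd (altWord t s m) (x + (0 : ℝ) • K.α s + (0 : ℝ) • K.α t)) :
      K.wordProd (altWord s t m) = K.wordProd (altWord t s m) :=
    LinearEquiv.ext fun x => by rw [start x]; exact hm x
  rcases key with ⟨h1, h2⟩ | ⟨h1, h2⟩ | ⟨h1, h2⟩ | ⟨h1, h2⟩ | ⟨h1, h2⟩ | ⟨h1, h2⟩
  on_goal 1 => refine ⟨2, by norm_num, braid 2 fun x => ?_, by rw [h1, h2]; decide⟩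
  on_goal 2 => refine ⟨3, by norm_num, braid 3 fun x => ?_, by rw [h1, h2]; decide⟩
  on_goal 3 => refine ⟨4, by norm_num, braid 4 fun x => ?_, by rw [h1, h2]; decide⟩
  on_goal 4 => refine ⟨4, by norm_num, braid 4 fun x => ?_, by rw [h1, h2]; decide⟩
  on_goal 5 => refine ⟨6, by norm_num, braid 6 fun x => ?_, by rw [h1, h2]; decide⟩
  on_goal 6 => refine ⟨6, by norm_num, braid 6 fun x => ?_, by rw [h1, h2]; decide⟩
  all_goals
    simp only [altWord, List.nil_append, List.cons_append, wordProd_cons, wordProd_nil, mul_one,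
      LinearEquiv.mul_apply, refl_left_apply, refl_right_apply, h1, h2]
    push_cast
    module

/-- An alternating word either sends `α_s` to a nonnegative combination of `α_s` and `α_t`, or its
product with `r_s` is represented by a shorter word. -/
lemma altWord_dichotomy {s t : I} (hst : s ≠ t) (n : ℕ) :
    (∃ x y : ℤ, 0 ≤ x ∧ 0 ≤ y ∧
      K.wordProd (altWord s t n) (K.α s) = (x : ℝ) • K.α s + (y : ℝ) • K.α t) ∨
    ∃ M : List I, M.length < n ∧ K.wordProd M = K.wordProd (altWord s t n) * K.refl s := by
  have hpos (h : 0 ≤ (altCoef (-K.a s t) (-K.a t s) n 1 0).1 ∧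
      0 ≤ (altCoef (-K.a s t) (-K.a t s) n 1 0).2) :
      ∃ x y : ℤ, 0 ≤ x ∧ 0 ≤ y ∧
        K.wordProd (altWord s t n) (K.α s) = (x : ℝ) • K.α s + (y : ℝ) • K.α t :=
    ⟨_, _, h.1, h.2, by rw [← wordProd_altWord_apply]; simp⟩
  rcases lt_or_ge (K.a s t * K.a t s) 4 with hlt | hge
  · obtain ⟨m, hm, hbraid, hcoef⟩ := K.exists_braid hst hlt
    rcases lt_or_ge n m with hn | hn
    · exact Or.inl (hpos (hcoef n hn))
    · right
      obtain ⟨k, rfl⟩ := Nat.exists_eq_add_of_le' hn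
      obtain ⟨L, hL, h⟩ := altWord_add s t k m
      obtain ⟨m, rfl⟩ := Nat.exists_eq_succ_of_ne_zero hm.ne'
      refine ⟨L ++ altWord s t m, by simp [hL, length_altWord], ?_⟩
      rw [h, wordProd_append, wordProd_append, hbraid, Nat.succ_eq_add_one, altWord]
      simp [mul_assoc, refl_mul_self]
  · refine Or.inl (hpos (altCoef_nonneg ?_ ?_ (by linarith) n zero_le_one le_rfl (by norm_num)))
    · linarith [K.offDiag s t hst]
    · linarith [K.offDiag t s hst.symm]

lemma word_eq_altWord_or_exists_shorter (s t : I) (u : List I) (hu : ∀ a ∈ u, a = s ∨ a = t) :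
    u = altWord s t u.length ∨
      ∃ M : List I, M.length < u.length ∧
        (K.wordProd M = K.wordProd u ∨ K.wordProd M = K.wordProd u * K.refl s) := by
  induction u using List.reverseRecOn generalizing s t with
  | nil => exact Or.inl rfl
  | append_singleton u b ih =>
    rcases hu b (by simp) with rfl | rfl
    · exact Or.inr ⟨u, by simp, Or.inr (by simp [mul_assoc, refl_mul_self])⟩
    · rcases ih b s fun a ha => (hu a (by simp [ha])).symm with h | ⟨M, hM, h | h⟩
      · left
        rw [List.length_append, List.length_singleton, altWord, ← h]
      · exact Or.inr ⟨M ++ [b], by simpa using hM, Or.inl (by simp [h])⟩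
      · exact Or.inr ⟨M, by simp; omega, Or.inl (by simp [h])⟩

/-! ### Real roots are positive or negative -/

lemma root_mem_Qplus_of_length_le {w : V ≃ₗ[ℝ] V} (hw : w ∈ K.weylGroup) (s : I)
    (hs : K.wordLength w ≤ K.wordLength (w * K.refl s)) : w (K.α s) ∈ K.Qplus := by
  induction hn : K.wordLength w using Nat.strong_induction_on generalizing w s with
  | _ n ih =>
  subst hn
  obtain ⟨L, hL, hLw⟩ := K.exists_reduced_word hw
  rcases List.eq_nil_or_concat' L with rfl | ⟨L', t, rfl⟩
  · rw [← hLw]; exact K.root_mem_Qplus s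
  rw [List.length_append, List.length_singleton] at hL
  have hLw' : K.wordProd L' * K.refl t = w := by simpa using hLw
  have hL' := K.wordLength_wordProd_le L'
  have hts : s ≠ t := by
    rintro rfl
    rw [← hLw', mul_assoc, refl_mul_self, mul_one, hLw'] at hs
    omega
  let p : ℕ → Prop := fun k => ∃ v ∈ K.weylGroup, ∃ u : List I, (∀ a ∈ u, a = s ∨ a = t) ∧
    w = v * K.wordProd u ∧ K.wordLength w = K.wordLength v + u.length ∧ K.wordLength v = k
  have hp : p (K.wordLength (K.wordProd L')) := by
    refine ⟨_, K.wordProd_mem L', [t], by simp, by simp [hLw'], ?_, rfl⟩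
    have := K.wordLength_mul_wordProd_le (K.wordProd_mem L') [t]
    rw [wordProd_cons, wordProd_nil, mul_one, hLw'] at this
    simp only [List.length_singleton] at this ⊢
    omega
  have hex : ∃ k, p k := ⟨_, hp⟩
  obtain ⟨v, hv, u, hu, hwv, hlen, hk⟩ := Nat.find_spec hex
  have hlt : K.wordLength v < K.wordLength w := by
    have := Nat.find_min' hex hp
    omega
  have hmin (a : I) (ha : a = s ∨ a = t) : K.wordLength v ≤ K.wordLength (v * K.refl a) := by
    by_contra! hcon
    have hw' : w = v * K.refl a * K.wordProd (a :: u) := by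
      rw [wordProd_cons, mul_assoc, ← mul_assoc (K.refl a), refl_mul_self, one_mul, hwv]
    have hva := mul_mem hv (K.refl_mem a)
    have h1 := K.wordLength_mul_wordProd_le hva (a :: u)
    rw [← hw'] at h1
    have h2 : p (K.wordLength (v * K.refl a)) := by
      refine ⟨_, hva, a :: u, ?_, hw', ?_, rfl⟩
      · intro b hb
        rcases List.mem_cons.1 hb with rfl | hb
        exacts [ha, hu b hb]
      · simp only [List.length_cons] at h1 ⊢
        omega
    have := Nat.find_min' hex h2
    omega
  have hvs := ih _ hlt hv s (hmin s (Or.inl rfl)) rfl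
  have hvt := ih _ hlt hv t (hmin t (Or.inr rfl)) rfl
  have hshort (M : List I) (hM : M.length < u.length)
      (h : K.wordProd M = K.wordProd u ∨ K.wordProd M = K.wordProd u * K.refl s) : False := by
    have h1 := K.wordLength_mul_wordProd_le hv M
    rcases h with h | h
    · rw [h, ← hwv] at h1; omega
    · rw [h, ← mul_assoc, ← hwv] at h1; omega
  rcases K.word_eq_altWord_or_exists_shorter s t u hu with h | ⟨M, hM, h⟩
  · rcases K.altWord_dichotomy hts u.length with ⟨x, y, hx, hy, h'⟩ | ⟨M, hM, h'⟩
    · rw [← h] at h'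
      rw [hwv, LinearEquiv.mul_apply, h', map_add, map_smul, map_smul]
      exact K.add_mem_Qplus (K.smul_mem_Qplus hvs hx) (K.smul_mem_Qplus hvt hy)
    · rw [← h] at h'
      exact (hshort M hM (Or.inr h')).elim
  · exact (hshort M hM h).elim

theorem root_pos_or_neg {w : V ≃ₗ[ℝ] V} (hw : w ∈ K.weylGroup) (i : I) :
    w (K.α i) ∈ K.Qplus ∨ -w (K.α i) ∈ K.Qplus := by
  rcases le_total (K.wordLength w) (K.wordLength (w * K.refl i)) with h | h
  · exact Or.inl (K.root_mem_Qplus_of_length_le hw i h)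
  · right
    have := K.root_mem_Qplus_of_length_le (mul_mem hw (K.refl_mem i)) i
      (by rwa [mul_assoc, refl_mul_self, mul_one])
    rw [LinearEquiv.mul_apply, refl_apply, coroot_self, two_smul, sub_add_cancel_left,
      map_neg] at this
    exact this

/-! ### Dual roots -/

/-- Equivariance of the map `α_k ↦ d_k α_k∨` given by the symmetrization. -/
lemma exists_coords_weyl {w : V ≃ₗ[ℝ] V} (hw : w ∈ K.weylGroup) (c : I → ℤ) :
    ∃ e : I → ℤ, w (∑ k, (c k : ℝ) • K.α k) = ∑ k, (e k : ℝ) • K.α k ∧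
      ∀ x, ∑ k, (e k * K.d k : ℝ) * K.coroot k (w x) = ∑ k, (c k * K.d k : ℝ) * K.coroot k x := by
  obtain ⟨L, rfl⟩ := K.exists_word hw
  clear hw
  induction L with
  | nil => exact ⟨c, rfl, fun x => rfl⟩
  | cons i L ih =>
    obtain ⟨e, h1, h2⟩ := ih
    refine ⟨e - Pi.single i (∑ k, e k * K.a i k), ?_, fun x => ?_⟩
    · rw [wordProd_cons, LinearEquiv.mul_apply, h1, refl_apply]
      simp [sub_smul, Finset.sum_sub_distrib, Pi.single_apply, K.cartanPairing]
    · rw [← h2 x, wordProd_cons, LinearEquiv.mul_apply]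
      generalize K.wordProd L x = y
      have hsym (k : I) : (K.d k : ℝ) * K.a k i = K.d i * K.a i k := by
        exact_mod_cast K.symmetrizable k i
      have e1 : ∑ k, (e k * K.d k : ℝ) * K.coroot k (K.refl i y) =
          ∑ k, (e k * K.d k : ℝ) * K.coroot k y -
            (∑ k, (e k : ℝ) * K.a i k) * K.d i * K.coroot i y := by
        rw [Finset.sum_mul, Finset.sum_mul, ← Finset.sum_sub_distrib]
        refine Finset.sum_congr rfl fun k _ => ?_
        rw [refl_apply, map_sub, map_smul, smul_eq_mul, K.cartanPairing]
        linear_combination (-(e k : ℝ) * K.coroot i y) * hsym k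
      have e2 : ∑ k, (((e - Pi.single i (∑ k, e k * K.a i k) : I → ℤ) k : ℝ) * K.d k) *
            K.coroot k (K.refl i y) =
          ∑ k, (e k * K.d k : ℝ) * K.coroot k (K.refl i y) -
            (∑ k, (e k : ℝ) * K.a i k) * K.d i * K.coroot i (K.refl i y) := by
        simp [sub_mul, Finset.sum_sub_distrib, Pi.single_apply]
      rw [e2, e1, coroot_refl_self]
      ring

lemma coroot_eq_of_root_eq {w : V ≃ₗ[ℝ] V} (hw : w ∈ K.weylGroup) {i j : I}
    (h : w (K.α j) = K.α i) (x : V) : K.coroot j (w.symm x) = K.coroot i x := by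
  obtain ⟨e, h1, h2⟩ := K.exists_coords_weyl hw (Pi.single j 1)
  have he : (fun k => (e k : ℝ)) = fun k => ((Pi.single i 1 : I → ℤ) k : ℝ) := by
    refine K.rootsIndep.fintypeLinearCombination_injective ?_
    simp only [Fintype.linearCombination_apply, ← h1]
    simp [Pi.single_apply, h]
  have he' (k : I) : (e k : ℝ) = ((Pi.single i 1 : I → ℤ) k : ℝ) := congrFun he k
  have h3 (y : V) : (K.d i : ℝ) * K.coroot i (w y) = K.d j * K.coroot j y := by
    have := h2 y
    simp only [he'] at this
    simpa [Pi.single_apply] using this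
  have hd : (K.d i : ℝ) = K.d j := by
    have := h3 (K.α j)
    rw [h, coroot_self, coroot_self] at this
    linarith
  have h4 := h3 (w.symm x)
  rw [LinearEquiv.apply_symm_apply, ← hd] at h4
  exact (mul_left_cancel₀ (by exact_mod_cast (K.dPos i).ne') h4).symm

lemma coord_eq {c e : I → ℝ} (h : ∑ k, c k • K.α k = ∑ k, e k • K.α k) : c = e :=
  K.rootsIndep.fintypeLinearCombination_injective
    (by simpa only [Fintype.linearCombination_apply] using h)

/-- `r_i` permutes the positive real roots other than `α_i`. -/
lemma refl_root_mem_Qplus {w : V ≃ₗ[ℝ] V} (hw : w ∈ K.weylGroup) (i j : I)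
    (h : w (K.α j) ∈ K.Qplus) : K.refl i (w (K.α j)) ∈ K.Qplus ∨ w (K.α j) = K.α i := by
  rcases K.root_pos_or_neg (mul_mem (K.refl_mem i) hw) j with hpos | hneg
  · exact Or.inl hpos
  right
  obtain ⟨c, hc⟩ := h
  obtain ⟨e, he⟩ := hneg
  rw [LinearEquiv.mul_apply, refl_apply] at he
  have hzero (k : I) (hk : k ≠ i) : c k = 0 := by
    have := K.coord_eq (c := fun k => -(c k : ℝ) + (Pi.single i (K.coroot i (w (K.α j))) : I → ℝ) k)
      (e := fun k => (e k : ℝ)) (by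
        rw [← he]
        simp only [add_smul, neg_smul, Finset.sum_add_distrib, Finset.sum_neg_distrib, ← hc]
        simp [Pi.single_apply]
        abel)
    have := congrFun this k
    simp only [Pi.single_apply, hk, if_false, add_zero] at this
    have h1 : (0 : ℝ) ≤ e k := Nat.cast_nonneg _
    have h2 : (0 : ℝ) ≤ c k := Nat.cast_nonneg _
    exact_mod_cast (by linarith : (c k : ℝ) = 0)
  have hci : w (K.α j) = (c i : ℝ) • K.α i := by
    rw [hc]
    refine Finset.sum_eq_single i (fun k _ hk => ?_) (by simp)
    simp [hzero k hk]
  obtain ⟨f, hf, -⟩ := K.exists_coords_weyl (inv_mem hw) (Pi.single i 1)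
  have hone : (c i : ℝ) * f j = 1 := by
    have := K.coord_eq (c := fun k => (c i : ℝ) * f k) (e := fun k => (Pi.single j 1 : I → ℝ) k) (by
      simp only [mul_smul, ← Finset.smul_sum, ← hf, ← map_smul]
      simp only [Pi.single_apply, Int.cast_ite, Int.cast_one, Int.cast_zero, ite_smul, one_smul,
        zero_smul, Finset.sum_ite_eq', Finset.mem_univ, if_true, ← hci]
      exact w.symm_apply_apply _)
    simpa using congrFun this j
  have hone' : (c i : ℤ) * f j = 1 := by exact_mod_cast hone
  have : (c i : ℤ) = 1 := Int.eq_one_of_mul_eq_one_right (by positivity) hone'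
  have : (c i : ℝ) = 1 := by exact_mod_cast this
  rw [hci, this, one_smul]

/-! ### Chains -/

lemma le_dist_of_chainLen {ν ν' : V} {p : ℕ} (hd : K.dist ν ν' ≠ 0) (h : K.chainLen p ν ν') :
    p ≤ K.dist ν ν' :=
  le_csSup (by by_contra hb; exact hd (Nat.sSup_of_not_bddAbove hb)) h

/-- A step of distance one which changes the sign of `⟨·, α_i∨⟩` from negative to positive is the
reflection in `α_i`. -/
lemma coroot_eq_of_dist_eq_one {ξ : V} {w : V ≃ₗ[ℝ] V} (hw : w ∈ K.weylGroup) {i j : I}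
    (hd : K.dist ξ (w (K.refl j (w.symm ξ))) = 1) (hβ : w (K.α j) ∈ K.Qplus)
    (hneg : K.coroot j (w.symm ξ) < 0) (hi : K.coroot i ξ < 0)
    (hi' : 0 < K.coroot i (w (K.refl j (w.symm ξ)))) (x : V) :
    K.coroot j (w.symm x) = K.coroot i x := by
  rcases K.refl_root_mem_Qplus hw i j hβ with h | h
  swap
  · exact K.coroot_eq_of_root_eq hw h x
  exfalso
  set ξ' := w (K.refl j (w.symm ξ)) with hξ'
  have s1 : K.StepDown ξ (K.refl i ξ) :=
    ⟨1, one_mem _, i, K.root_mem_Qplus i, hi, rfl⟩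
  have hsymm (y : V) : (K.refl i * w).symm (K.refl i y) = w.symm y := by
    rw [LinearEquiv.symm_apply_eq, LinearEquiv.mul_apply, LinearEquiv.apply_symm_apply]
  have s2 : K.StepDown (K.refl i ξ) (K.refl i ξ') := by
    refine ⟨K.refl i * w, mul_mem (K.refl_mem i) hw, j, h, ?_, ?_⟩
    · rwa [hsymm]
    · rw [hsymm, LinearEquiv.mul_apply]
  have s3 : K.StepDown (K.refl i ξ') ξ' := by
    refine ⟨1, one_mem _, i, K.root_mem_Qplus i, ?_, (K.refl_refl i ξ').symm⟩
    change K.coroot i (K.refl i ξ') < 0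
    rw [coroot_refl_self]
    linarith
  have hchain : K.chainLen 3 ξ ξ' := by
    refine ⟨fun n => match n with | 0 => ξ | 1 => K.refl i ξ | 2 => K.refl i ξ' | _ => ξ',
      rfl, rfl, fun q hq => ?_⟩
    interval_cases q
    exacts [s1, s2, s3]
  have := K.le_dist_of_chainLen (by omega) hchain
  omega

lemma reflection_step (w : V ≃ₗ[ℝ] V) (j : I) (ξ : V) :
    ξ - w (K.refl j (w.symm ξ)) = K.coroot j (w.symm ξ) • w (K.α j) := by
  rw [refl_apply, map_sub, map_smul, LinearEquiv.apply_symm_apply, sub_sub_cancel]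

lemma smul_sub_mem_rootLattice_of_step {σ : ℝ} {w : V ≃ₗ[ℝ] V} {j : I} {ξ ξ' : V} {n : ℤ}
    (hβ : w (K.α j) ∈ K.Qplus) (hξ : ξ' = w (K.refl j (w.symm ξ)))
    (hn : σ * K.coroot j (w.symm ξ) = n) : σ • (ξ - ξ') ∈ K.rootLattice := by
  rw [hξ, reflection_step, smul_smul, hn, Int.cast_smul_eq_zsmul]
  exact zsmul_mem (K.Qplus_subset_rootLattice hβ) n

lemma SigmaChain.smul_sub_mem {K : KacMoodyData I V} {σ : ℚ} {ν ν' : V}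
    (h : K.SigmaChain σ ν ν') : (σ : ℝ) • (ν - ν') ∈ K.rootLattice := by
  obtain ⟨p, -, ξ, rfl, rfl, hstep⟩ := h
  have key : ∀ q ≤ p, (σ : ℝ) • (ξ 0 - ξ q) ∈ K.rootLattice := by
    intro q
    induction q with
    | zero => intro _; simp
    | succ q ih =>
      intro hq
      obtain ⟨-, w, -, j, hβ, hξ, n, -, hn⟩ := hstep q hq
      have := add_mem (ih (by omega)) (K.smul_sub_mem_rootLattice_of_step hβ hξ hn)
      rwa [← smul_add, sub_add_sub_cancel] at this
  exact key p le_rfl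

/-- If `⟨·, α_i∨⟩` passes from nonpositive to nonnegative along a `σ`-chain from `ν`, then
`σ ⟨ν, α_i∨⟩` is an integer. -/
lemma SigmaChain.coroot_int {K : KacMoodyData I V} {σ : ℚ} {ν ν' : V} (h : K.SigmaChain σ ν ν')
    (hσ : 0 < σ) {i : I} (hν : K.coroot i ν ≤ 0) (hν' : 0 ≤ K.coroot i ν') :
    ∃ n : ℤ, (σ : ℝ) * K.coroot i ν = n := by
  obtain ⟨p, -, ξ, rfl, rfl, hstep⟩ := h
  have hσ' : (0 : ℝ) < σ := by exact_mod_cast hσ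
  by_contra hcon
  have key : ∀ q ≤ p, K.coroot i (ξ q) < 0 ∧
      ∃ n : ℤ, (σ : ℝ) * K.coroot i (ξ 0) - σ * K.coroot i (ξ q) = n := by
    intro q
    induction q with
    | zero =>
      refine fun _ => ⟨hν.lt_of_ne fun h0 => hcon ⟨0, by simp [h0]⟩, 0, by simp⟩
    | succ q ih =>
      intro hq
      obtain ⟨hlt, m, hm⟩ := ih (by omega)
      obtain ⟨hd, w, hw, j, hβ, hξ, n, hn0, hn⟩ := hstep q hq
      obtain ⟨k, hk⟩ := K.coroot_int_of_mem_rootLattice i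
        (K.smul_sub_mem_rootLattice_of_step hβ hξ hn)
      rw [map_smul, map_sub, smul_eq_mul] at hk
      have hcongr : (σ : ℝ) * K.coroot i (ξ 0) - σ * K.coroot i (ξ (q + 1)) = (m + k : ℤ) := by
        push_cast
        linarith
      refine ⟨?_, m + k, hcongr⟩
      rcases lt_trichotomy (K.coroot i (ξ (q + 1))) 0 with hc | hc | hc
      · exact hc
      · exact (hcon ⟨m + k, by rw [← hcongr, hc]; ring⟩).elim
      · have hneg : K.coroot j (w.symm (ξ q)) < 0 := by
          by_contra! hge
          have h1 := mul_nonneg hσ'.le hge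
          have h2 : (n : ℝ) < 0 := by exact_mod_cast hn0
          linarith
        rw [hξ] at hd hc
        rw [K.coroot_eq_of_dist_eq_one hw hd hβ hneg hlt hc (ξ q)] at hn
        exact (hcon ⟨m + n, by push_cast; linarith⟩).elim
  exact (key p le_rfl).1.not_ge hν'

/-! ### The path of an LS datum -/

namespace LSData

variable {K} {μ : V} (π : K.LSData μ)

lemma path_zero : π.path 0 = 0 := by
  refine Finset.sum_eq_zero fun k _ => ?_
  have h (j : Fin (π.s + 1)) : (0 : ℝ) ≤ π.τ j := by
    have := π.τ_mono.monotone (Fin.zero_le j)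
    rw [π.τ_zero] at this
    exact_mod_cast this
  rw [min_eq_left (h _), min_eq_left (h _), sub_self, zero_smul]

lemma path_sub_path (u : Fin π.s) {t t' : ℝ} (h1 : (π.τ u.castSucc : ℝ) ≤ t)
    (h2 : t ≤ π.τ u.succ) (h1' : (π.τ u.castSucc : ℝ) ≤ t') (h2' : t' ≤ π.τ u.succ) :
    π.path t' - π.path t = (t' - t) • π.ν u := by
  have hmono {j k : Fin (π.s + 1)} (h : j ≤ k) : (π.τ j : ℝ) ≤ π.τ k := by
    exact_mod_cast π.τ_mono.monotone h
  rw [LSData.path, LSData.path, ← Finset.sum_sub_distrib, Finset.sum_eq_single u _ (by simp)]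
  · rw [min_eq_left h2, min_eq_right h1, min_eq_left h2', min_eq_right h1']
    module
  · intro k _ hne
    rcases lt_or_gt_of_ne hne with h | h
    · have e1 : (π.τ k.succ : ℝ) ≤ π.τ u.castSucc := by
        apply hmono; simp only [Fin.le_def, Fin.lt_def, Fin.val_succ, Fin.val_castSucc] at h ⊢; omega
      have e2 : (π.τ k.castSucc : ℝ) ≤ π.τ u.castSucc := by
        apply hmono; simp only [Fin.le_def, Fin.lt_def, Fin.val_castSucc] at h ⊢; omega
      rw [min_eq_right (e1.trans h1), min_eq_right (e2.trans h1), min_eq_right (e1.trans h1'),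
        min_eq_right (e2.trans h1'), sub_self]
    · have e1 : (π.τ u.succ : ℝ) ≤ π.τ k.succ := by
        apply hmono; simp only [Fin.le_def, Fin.lt_def, Fin.val_succ] at h ⊢; omega
      have e2 : (π.τ u.succ : ℝ) ≤ π.τ k.castSucc := by
        apply hmono; simp only [Fin.le_def, Fin.lt_def, Fin.val_succ, Fin.val_castSucc] at h ⊢; omega
      rw [min_eq_left (h2.trans e1), min_eq_left (h2.trans e2), min_eq_left (h2'.trans e1),
        min_eq_left (h2'.trans e2), sub_self, sub_self, sub_self]

lemma path_sub_smul_mem (u : Fin π.s) {t : ℝ} (h1 : (π.τ u.castSucc : ℝ) ≤ t)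
    (h2 : t ≤ π.τ u.succ) : π.path t - t • π.ν u ∈ K.rootLattice := by
  have hmono (u : Fin π.s) : (π.τ u.castSucc : ℝ) ≤ π.τ u.succ := by
    exact_mod_cast π.τ_mono.monotone u.castSucc_lt_succ.le
  obtain ⟨u, hu⟩ := u
  induction u generalizing t with
  | zero =>
    have h0 : (π.τ (Fin.castSucc ⟨0, hu⟩) : ℝ) = 0 := by
      have := π.τ_zero
      simpa using this
    have := π.path_sub_path ⟨0, hu⟩ h0.le (h0 ▸ hmono _) h1 h2
    rw [path_zero, sub_zero, sub_zero] at this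
    rw [this, sub_self]
    exact zero_mem _
  | succ u ih =>
    have hlt : u < π.s := by omega
    have hprev := ih hlt (t := π.τ (Fin.succ ⟨u, hlt⟩)) (hmono _) le_rfl
    have hchain := (π.chainCond u hu).smul_sub_mem
    have hdiff := π.path_sub_path ⟨u + 1, hu⟩ le_rfl (hmono _) h1 h2
    convert add_mem hprev hchain using 1
    rw [← sub_add_cancel (π.path t) (π.path (π.τ (Fin.castSucc ⟨u + 1, hu⟩))), hdiff]
    change _ = π.path (π.τ (Fin.castSucc ⟨u + 1, hu⟩)) -
      (π.τ (Fin.castSucc ⟨u + 1, hu⟩) : ℝ) • π.ν ⟨u, hlt⟩ +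
        (π.τ (Fin.castSucc ⟨u + 1, hu⟩) : ℝ) • (π.ν ⟨u, hlt⟩ - π.ν ⟨u + 1, hu⟩)
    module

lemma path_one_mem (hμ : μ ∈ K.P) : π.path 1 ∈ K.P := by
  obtain ⟨n, hn⟩ := Nat.exists_eq_succ_of_ne_zero π.spos.ne'
  have hlt : n < π.s := by omega
  have hlast : (π.τ (Fin.succ ⟨n, hlt⟩) : ℝ) = 1 := by
    have : Fin.succ ⟨n, hlt⟩ = Fin.last π.s := Fin.ext hn.symm
    rw [this, π.τ_last, Rat.cast_one]
  have h := π.path_sub_smul_mem ⟨n, hlt⟩ (t := 1)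
    (by rw [← hlast]; exact_mod_cast π.τ_mono.monotone (Fin.castSucc_lt_succ).le) hlast.ge
  obtain ⟨w, hw, hν⟩ := π.mem ⟨n, hlt⟩
  rw [one_smul, hν] at h
  have := add_mem (K.rootLattice_le h) (K.weyl_mem_P hw hμ)
  rwa [sub_add_cancel] at this

lemma exists_crossing (p : Fin (π.s + 1) → Prop) (h0 : p 0) (h1 : ¬ p (Fin.last π.s)) :
    ∃ u : Fin π.s, p u.castSucc ∧ ¬ p u.succ := by
  by_contra! h
  exact h1 (Fin.induction (motive := p) h0 h _)

lemma continuous_H (i : I) : Continuous (K.H i π.path) := by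
  have : K.H i π.path = fun t => ∑ k : Fin π.s,
      (min t (π.τ k.succ : ℝ) - min t (π.τ k.castSucc : ℝ)) * K.coroot i (π.ν k) := by
    funext t
    simp [KacMoodyData.H, LSData.path]
  rw [this]
  fun_prop

lemma H_sub_mul_int (i : I) (u : Fin π.s) {t : ℝ} (h1 : (π.τ u.castSucc : ℝ) ≤ t)
    (h2 : t ≤ π.τ u.succ) : ∃ n : ℤ, K.H i π.path t - t * K.coroot i (π.ν u) = n := by
  obtain ⟨n, hn⟩ := K.coroot_int_of_mem_rootLattice i (π.path_sub_smul_mem u h1 h2)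
  exact ⟨n, by rw [← hn, map_sub, map_smul, smul_eq_mul, KacMoodyData.H]⟩

lemma H_eq (i : I) (u : Fin π.s) {t t' : ℝ} (h1 : (π.τ u.castSucc : ℝ) ≤ t)
    (h2 : t ≤ π.τ u.succ) (h1' : (π.τ u.castSucc : ℝ) ≤ t') (h2' : t' ≤ π.τ u.succ) :
    K.H i π.path t' = K.H i π.path t + (t' - t) * K.coroot i (π.ν u) := by
  have := congrArg (K.coroot i) (π.path_sub_path u h1 h2 h1' h2')
  rw [map_sub, map_smul, smul_eq_mul] at this
  simp only [KacMoodyData.H]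
  linarith

lemma τ_mem (k : Fin (π.s + 1)) : (π.τ k : ℝ) ∈ Set.Icc (0 : ℝ) 1 := by
  have h0 := π.τ_mono.monotone (Fin.zero_le k)
  have h1 := π.τ_mono.monotone (Fin.le_last k)
  rw [π.τ_zero] at h0
  rw [π.τ_last] at h1
  exact ⟨by exact_mod_cast h0, by exact_mod_cast h1⟩

open Filter Topology in
lemma coroot_nonneg_of_isLocalMinOn {i : I} {t : ℝ}
    (hmin : IsLocalMinOn (K.H i π.path) (Set.Icc 0 1) t) {u : Fin π.s}
    (h1 : (π.τ u.castSucc : ℝ) ≤ t) (h2 : t < π.τ u.succ) : 0 ≤ K.coroot i (π.ν u) := by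
  have hsub : Set.Ioo t (π.τ u.succ) ⊆ Set.Icc (0 : ℝ) 1 := fun x hx =>
    ⟨(π.τ_mem _).1.trans (h1.trans hx.1.le), hx.2.le.trans (π.τ_mem _).2⟩
  have hne : (𝓝[Set.Ioo t (π.τ u.succ : ℝ)] t).NeBot := by
    rw [nhdsWithin_Ioo_eq_nhdsGT h2]; infer_instance
  obtain ⟨x, hx, hxm⟩ := ((hmin.filter_mono (nhdsWithin_mono t hsub)).and
    self_mem_nhdsWithin).exists
  rw [π.H_eq i u h1 h2.le (h1.trans hxm.1.le) hxm.2.le] at hx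
  exact nonneg_of_mul_nonneg_right (by linarith) (sub_pos.2 hxm.1)

open Filter Topology in
lemma coroot_nonpos_of_isLocalMinOn {i : I} {t : ℝ}
    (hmin : IsLocalMinOn (K.H i π.path) (Set.Icc 0 1) t) {u : Fin π.s}
    (h1 : (π.τ u.castSucc : ℝ) < t) (h2 : t ≤ π.τ u.succ) : K.coroot i (π.ν u) ≤ 0 := by
  have hsub : Set.Ioo (π.τ u.castSucc : ℝ) t ⊆ Set.Icc (0 : ℝ) 1 := fun x hx =>
    ⟨(π.τ_mem _).1.trans hx.1.le, hx.2.le.trans (h2.trans (π.τ_mem _).2)⟩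
  have hne : (𝓝[Set.Ioo (π.τ u.castSucc : ℝ) t] t).NeBot := by
    rw [nhdsWithin_Ioo_eq_nhdsLT h1]; infer_instance
  obtain ⟨x, hx, hxm⟩ := ((hmin.filter_mono (nhdsWithin_mono t hsub)).and
    self_mem_nhdsWithin).exists
  rw [π.H_eq i u h1.le h2 hxm.1.le (hxm.2.le.trans h2)] at hx
  by_contra! hpos
  linarith [mul_pos (sub_pos.2 hxm.2) hpos]

/-- Local minimum values of `H_i^π` are integers. -/
theorem H_int_of_isLocalMinOn (hμ : μ ∈ K.P) (i : I) {t : ℝ} (ht : t ∈ Set.Icc (0 : ℝ) 1)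
    (hmin : IsLocalMinOn (K.H i π.path) (Set.Icc 0 1) t) : ∃ n : ℤ, K.H i π.path t = n := by
  rcases ht.1.eq_or_lt with rfl | h0
  · exact ⟨0, by simp [KacMoodyData.H, path_zero]⟩
  rcases ht.2.eq_or_lt with rfl | h1
  · exact K.pairingInt i _ (π.path_one_mem hμ)
  obtain ⟨u, hu1, hu2⟩ := π.exists_crossing (fun k => (π.τ k : ℝ) < t)
    (by simpa [π.τ_zero] using h0) (by simpa [π.τ_last] using h1.le)
  rw [not_lt] at hu2
  have hnonpos := π.coroot_nonpos_of_isLocalMinOn hmin hu1 hu2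
  obtain ⟨n, hn⟩ := π.H_sub_mul_int i u hu1.le hu2
  suffices ∃ m : ℤ, t * K.coroot i (π.ν u) = m by
    obtain ⟨m, hm⟩ := this
    exact ⟨n + m, by push_cast; linarith⟩
  rcases hu2.eq_or_lt with hteq | hlt
  · have hus : u.1 + 1 < π.s := by
      by_contra hcon
      have : u.succ = Fin.last π.s := Fin.ext (by simp; omega)
      rw [this, π.τ_last, Rat.cast_one] at hteq
      exact h1.ne hteq
    have hnonneg := π.coroot_nonneg_of_isLocalMinOn hmin (u := ⟨u.1 + 1, hus⟩) hteq.ge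
      (by rw [hteq]; exact_mod_cast π.τ_mono (by simp [Fin.lt_def]))
    rw [hteq] at h0 ⊢
    exact (π.chainCond u.1 hus).coroot_int (by exact_mod_cast h0) hnonpos hnonneg
  · have hzero := hnonpos.antisymm (π.coroot_nonneg_of_isLocalMinOn hmin hu1.le hlt)
    exact ⟨0, by simp [hzero]⟩

lemma exists_isMinOn_mval (i : I) : ∃ t ∈ Set.Icc (0 : ℝ) 1,
    IsMinOn (K.H i π.path) (Set.Icc 0 1) t ∧ K.mval i π.path = K.H i π.path t := by
  obtain ⟨t, ht, hmin⟩ := isCompact_Icc.exists_isMinOn (Set.nonempty_Icc.2 zero_le_one)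
    (π.continuous_H i).continuousOn
  have hleast : IsLeast (K.H i π.path '' Set.Icc 0 1) (K.H i π.path t) := by
    refine ⟨⟨t, ht, rfl⟩, ?_⟩
    rintro _ ⟨x, hx, rfl⟩
    exact hmin hx
  exact ⟨t, ht, hmin, hleast.csInf_eq⟩

end LSData

end KacMoodyData

end LSPaper

open LSPaper in
theorem statement2 {I V : Type*} [Fintype I] [DecidableEq I] [AddCommGroup V] [Module ℝ V]
    (K : KacMoodyData I V) (μ : V) (hμ : μ ∈ K.P)
    (f : ℝ → V) (hf : f ∈ K.B μ) :
    f 1 ∈ K.P ∧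
    ∀ i : I,
      (∀ t ∈ Set.Icc (0 : ℝ) 1, IsLocalMinOn (K.H i f) (Set.Icc 0 1) t →
        ∃ n : ℤ, K.H i f t = (n : ℝ)) ∧
      (∃ n : ℤ, n ≤ 0 ∧ K.mval i f = (n : ℝ)) ∧
      (∃ n : ℤ, 0 ≤ n ∧ K.H i f 1 - K.mval i f = (n : ℝ)) := by
  obtain ⟨π, rfl⟩ := hf
  refine ⟨π.path_one_mem hμ, fun i => ?_⟩
  obtain ⟨t, ht, hmin, hval⟩ := π.exists_isMinOn_mval i
  obtain ⟨n, hn⟩ := π.H_int_of_isLocalMinOn hμ i ht hmin.localize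
  obtain ⟨m, hm⟩ := K.pairingInt i _ (π.path_one_mem hμ)
  have h0 : K.H i π.path t ≤ K.H i π.path 0 := hmin ⟨le_rfl, zero_le_one⟩
  have h1 : K.H i π.path t ≤ K.H i π.path 1 := hmin ⟨zero_le_one, le_rfl⟩
  have hm' : K.H i π.path 1 = m := hm
  have hzero : K.H i π.path 0 = 0 := by simp [KacMoodyData.H, π.path_zero]
  rw [hn, hzero] at h0
  rw [hn, hm'] at h1
  refine ⟨fun t ht h => π.H_int_of_isLocalMinOn hμ i ht h, ⟨n, by exact_mod_cast h0, ?_⟩,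
    m - n, sub_nonneg.2 (by exact_mod_cast h1), ?_⟩
  · rw [hval, hn]
  · rw [hval, hn, hm', Int.cast_sub]
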